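/- Let A be an Artin algebra and (C,T) an n-tilting pair of self-orthogonal modules in mod A. Then _CX = check(_TX) ∩ C^⊥: a module M lies in _CX if and only if Ext^i(C,M)=0 for all i≥1 and M admits a finite coresolution by modules in _TX. -/

import Mathlib

open CategoryTheory CategoryTheory.Limits Opposite

noncomputable section

universe v u

variable (C : Type u) [Category.{v} C] [Abelian C] [EnoughProjectives C] [EnoughInjectives C]

/-- The `i`-th Ext group from `X` to `Y` vanishes. -/
def extZero (i : ℕ) (X Y : C) : Prop :=
  Limits.IsZero (((Ext ℤ C i).obj (op X)).obj Y)

variable {C}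

/-- A class of objects is self-orthogonal if all positive-degree Ext groups
between its members vanish. -/
def SelfOrth (ω : Set C) : Prop :=
  ∀ W ∈ ω, ∀ W' ∈ ω, ∀ i ≥ 1, extZero C i W W'

/-- The right orthogonal class `ω^⊥`. -/
def rightPerp (ω : Set C) : Set C :=
  {Y | ∀ W ∈ ω, ∀ i ≥ 1, extZero C i W Y}

/-- The left orthogonal class `^⊥ω`. -/
def leftPerp (ω : Set C) : Set C :=
  {Y | ∀ W ∈ ω, ∀ i ≥ 1, extZero C i Y W}

/-- There exists a short exact sequence `0 → X → Y → Z → 0`. -/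
def SES (X Y Z : C) : Prop :=
  ∃ (f : X ⟶ Y) (g : Y ⟶ Z) (w : f ≫ g = 0), (ShortComplex.mk f g w).ShortExact

/-- `coresol ω n` is the class of objects admitting an `ω`-coresolution
`0 → X → W⁰ → ⋯ → Wⁿ → 0` of length `n`. -/
def coresol (ω : Set C) : ℕ → Set C
  | 0 => {X | ∃ W ∈ ω, Nonempty (X ≅ W)}
  | n + 1 => {X | ∃ W ∈ ω, ∃ X', SES X W X' ∧ X' ∈ coresol ω n}

/-- `check(ω)`: objects with a finite `ω`-coresolution. -/
def checkCat (ω : Set C) : Set C := ⋃ n, coresol ω n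

/-- `resol ω n` is the class of objects admitting an `ω`-resolution
`0 → Wₙ → ⋯ → W₀ → X → 0` of length `n`. -/
def resol (ω : Set C) : ℕ → Set C
  | 0 => {X | ∃ W ∈ ω, Nonempty (X ≅ W)}
  | n + 1 => {X | ∃ W ∈ ω, ∃ X', SES X' W X ∧ X' ∈ resol ω n}

/-- `hat(ω)`: objects with a finite `ω`-resolution. -/
def hatCat (ω : Set C) : Set C := ⋃ n, resol ω n

/-- `_ωX`: objects admitting an exact proper `ω`-resolution
`⋯ → W₁ → W₀ → A → 0` with all syzygies in `ω^⊥`. -/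
def omX (ω : Set C) : Set C :=
  {A | ∃ K W : ℕ → C, K 0 = A ∧ (∀ i, W i ∈ ω) ∧
    (∀ i, K (i + 1) ∈ rightPerp ω) ∧ ∀ i, SES (K (i + 1)) (W i) (K i)}

/-- `X_ω`: objects admitting an exact coproper `ω`-coresolution
`0 → A → W⁰ → W¹ → ⋯` with all cosyzygies in `^⊥ω`. -/
def Xom (ω : Set C) : Set C :=
  {A | ∃ K W : ℕ → C, K 0 = A ∧ (∀ i, W i ∈ ω) ∧
    (∀ i, K (i + 1) ∈ leftPerp ω) ∧ ∀ i, SES (K i) (W i) (K (i + 1))}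

/-- `Pres^n_D(ω)`: objects `M` with an exact sequence
`0 → X → Tₙ → ⋯ → T₁ → M → 0`, `Tᵢ ∈ ω`, `X ∈ D`. -/
def Pres (D ω : Set C) : ℕ → Set C
  | 0 => D
  | n + 1 => {M | ∃ T ∈ ω, ∃ X, SES X T M ∧ X ∈ Pres D ω n}

/-- `ω`-codimension: the least length of an `ω`-coresolution. -/
def codim (ω : Set C) (M : C) : ℕ := sInf {n | M ∈ coresol ω n}

/-- `I` is a relative injective cogenerator of `Y`. -/
def RelInjCogen (I Y : Set C) : Prop :=
  I ⊆ Y ∧ (∀ X ∈ I, ∀ Z ∈ Y, ∀ i ≥ 1, extZero C i Z X) ∧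
    ∀ Z ∈ Y, ∃ I₀ ∈ I, ∃ Z', Z' ∈ Y ∧ SES Z I₀ Z'

/-- The direct sum of `n + 1` copies of `T`. -/
def nsum (T : C) : ℕ → C
  | 0 => T
  | n + 1 => T ⊞ nsum T n

/-- `add T`: direct summands of finite direct sums of copies of `T`. -/
def addOf (T : C) : Set C :=
  {X | ∃ (n : ℕ) (Y : C), Nonempty ((X ⊞ Y) ≅ nsum T n)}


section ArtinAlgebra

variable (R : Type) [CommRing R] [IsArtinianRing R]
variable (A : Type) [Ring A] [Algebra R A] [Module.Finite R A]
variable [Abelian (FGModuleCat A)] [EnoughProjectives (FGModuleCat A)]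
variable [EnoughInjectives (FGModuleCat A)]

/-- `M` is a self-orthogonal module: `Ext^i(M, M) = 0` for all `i ≥ 1`. -/
def SelfOrthMod (M : FGModuleCat A) : Prop :=
  ∀ i ≥ 1, extZero (FGModuleCat A) i M M

/-- `(C, T)` is a tilting pair in `mod A`. -/
def TiltingPair (Cm Tm : FGModuleCat A) : Prop :=
  SelfOrthMod A Cm ∧ SelfOrthMod A Tm ∧
    Tm ∈ hatCat (addOf Cm) ∧ Cm ∈ checkCat (addOf Tm)

/-- `(C, T)` is an `n`-tilting pair: a tilting pair with `add C`-resolution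
dimension of `add T` at most `n`. -/
def nTiltingPair (Cm Tm : FGModuleCat A) (n : ℕ) : Prop :=
  TiltingPair A Cm Tm ∧ ∀ X ∈ addOf Tm, X ∈ resol (addOf Cm) n

end ArtinAlgebra

section AbelianLemmas

universe w

open scoped ZeroObject

variable {C : Type u} [Category.{v} C] [Abelian C]

lemma shortExact_of_isPullback {P A U X Y : C} {f : A ⟶ U} {g : U ⟶ X} {w : f ≫ g = 0}
    (hS : (ShortComplex.mk f g w).ShortExact) {fst : P ⟶ U} {snd : P ⟶ Y} {h : Y ⟶ X}
    (hP : IsPullback fst snd g h) :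
    (ShortComplex.mk (hP.lift f 0 (by simp [w])) snd (by simp)).ShortExact := by
  have := hS.mono_f
  have := hS.epi_g
  have : Mono (hP.lift f 0 (by simp [w])) := by
    have : Mono (hP.lift f 0 (by simp [w]) ≫ fst) := by simpa
    exact mono_of_mono _ fst
  have : Epi snd := (MorphismProperty.epimorphisms C).of_isPullback hP
    (MorphismProperty.epimorphisms.infer_property g)
  refine ShortComplex.ShortExact.mk' (ShortComplex.exact_of_f_is_kernel _ ?_) ‹_› ‹_›
  refine KernelFork.IsLimit.ofι' _ _ fun {Z} k hk => ?_
  refine ⟨hS.fIsKernel.lift (KernelFork.ofι (k ≫ fst) ?_), ?_⟩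
  · simp only [Category.assoc]
    rw [hP.w, reassoc_of% hk, zero_comp]
  · apply hP.hom_ext
    · simpa using hS.fIsKernel.fac (KernelFork.ofι (k ≫ fst) _) WalkingParallelPair.zero
    · simpa using hk.symm

lemma SES.op {X Y Z : C} (h : SES X Y Z) : SES (op Z) (op Y) (op X) := by
  obtain ⟨f, g, w, hS⟩ := h
  exact ⟨g.op, f.op, by rw [← op_comp, w, op_zero], hS.op⟩

lemma SES.unop {X Y Z : Cᵒᵖ} (h : SES X Y Z) : SES (unop Z) (unop Y) (unop X) := by
  obtain ⟨f, g, w, hS⟩ := h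
  exact ⟨g.unop, f.unop, by rw [← unop_comp, w, unop_zero], hS.unop⟩

lemma SES.of_iso {X Y Z X' Y' Z' : C} (h : SES X Y Z) (e₁ : X ≅ X') (e₂ : Y ≅ Y')
    (e₃ : Z ≅ Z') : SES X' Y' Z' := by
  obtain ⟨f, g, w, hS⟩ := h
  refine ⟨e₁.inv ≫ f ≫ e₂.hom, e₂.inv ≫ g ≫ e₃.hom, by simp [reassoc_of% w], ?_⟩
  exact ShortComplex.shortExact_of_iso
    (ShortComplex.isoMk e₁ e₂ e₃ (by simp) (by simp)) hS

lemma SES.biprod_inl_snd (X Y : C) : SES X (X ⊞ Y) Y :=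
  ⟨biprod.inl, biprod.snd, by simp,
    (ShortComplex.Splitting.ofHasBinaryBiproduct X Y).shortExact⟩

lemma SES.biprod_inr_fst (X Y : C) : SES Y (X ⊞ Y) X :=
  (SES.biprod_inl_snd Y X).of_iso (Iso.refl _) (biprod.braiding _ _) (Iso.refl _)

lemma SES.of_isZero_left (X : C) {Z : C} (hZ : IsZero Z) : SES Z X X := by
  refine ⟨0, 𝟙 X, by simp, ?_⟩
  have : Mono (𝟙 X) := inferInstance
  exact .mk' ((ShortComplex.exact_iff_mono _ rfl).2 this) (hZ.mono _) (inferInstance : Epi (𝟙 X))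

lemma SES.of_isZero_right (X : C) {Z : C} (hZ : IsZero Z) : SES X X Z :=
  SES.unop (SES.of_isZero_left (Opposite.op X) hZ.op)

/-- Pulling back two epimorphisms onto the same object. -/
lemma SES.pullback {A U X B V : C} (h₁ : SES A U X) (h₂ : SES B V X) :
    ∃ P, SES A P V ∧ SES B P U := by
  obtain ⟨f, g, w, hS⟩ := h₁
  obtain ⟨f', g', w', hS'⟩ := h₂
  have hP := IsPullback.of_hasPullback g g'
  exact ⟨_, ⟨_, _, _, shortExact_of_isPullback hS hP⟩,
    ⟨_, _, _, shortExact_of_isPullback hS' hP.flip⟩⟩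

/-- Pushing out two monomorphisms from the same object. -/
lemma SES.pushout {A U X V Y : C} (h₁ : SES A U X) (h₂ : SES A V Y) :
    ∃ P, SES U P Y ∧ SES V P X := by
  obtain ⟨P, h, h'⟩ := h₁.op.pullback h₂.op
  exact ⟨_, h'.unop, h.unop⟩

/-- The kernel of a composition of epimorphisms. -/
lemma SES.comp_epi {K B Y L Z : C} (h₁ : SES K B Y) (h₂ : SES L Y Z) :
    ∃ G, SES G B Z ∧ SES K G L := by
  obtain ⟨f, g, w, hS⟩ := h₁
  obtain ⟨i, p, w', hS'⟩ := h₂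
  have hP := IsPullback.of_hasPullback g i
  have := hS.epi_g
  have : Mono i := hS'.mono_f
  have : Epi p := hS'.epi_g
  have : Epi (g ≫ p) := epi_comp _ _
  have hw : pullback.fst g i ≫ g ≫ p = 0 := by
    rw [pullback.condition_assoc, w', comp_zero]
  refine ⟨_, ⟨pullback.fst g i, g ≫ p, hw,
    .mk' (ShortComplex.exact_of_f_is_kernel _ ?_) inferInstance ‹_›⟩,
    ⟨_, _, _, shortExact_of_isPullback hS hP⟩⟩
  refine KernelFork.IsLimit.ofι' _ _ fun {W} k hk => ?_
  have hk' : (k ≫ g) ≫ p = 0 := by simpa using hk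
  exact ⟨pullback.lift k (hS'.fIsKernel.lift (KernelFork.ofι (k ≫ g) hk'))
    (hS'.fIsKernel.fac (KernelFork.ofι (k ≫ g) hk') WalkingParallelPair.zero).symm,
    pullback.lift_fst _ _ _⟩

/-- The cokernel of a composition of monomorphisms. -/
lemma SES.comp_mono {X B K E L : C} (h₁ : SES X B K) (h₂ : SES B E L) :
    ∃ G, SES X E G ∧ SES K G L := by
  obtain ⟨G, h, h'⟩ := h₂.op.comp_epi h₁.op
  exact ⟨_, h.unop, h'.unop⟩

/-- Adding an identity to the two left-hand terms. -/
lemma SES.biprod_left {X Y Z : C} (h : SES X Y Z) (D : C) : SES (D ⊞ X) (D ⊞ Y) Z := by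
  obtain ⟨f, g, w, hS⟩ := h
  have : Mono f := hS.mono_f
  have : Epi g := hS.epi_g
  have hw : biprod.map (𝟙 D) f ≫ biprod.snd ≫ g = 0 := by simp [w]
  refine ⟨_, _, hw, .mk' (ShortComplex.exact_of_f_is_kernel _ ?_) ?_ (epi_comp _ _)⟩
  · refine KernelFork.IsLimit.ofι' _ _ fun {W} k hk => ?_
    have hk' : (k ≫ biprod.snd) ≫ g = 0 := by simpa using hk
    refine ⟨biprod.lift (k ≫ biprod.fst)
      (hS.fIsKernel.lift (KernelFork.ofι (k ≫ biprod.snd) hk')), ?_⟩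
    apply biprod.hom_ext
    · simp
    · simpa using hS.fIsKernel.fac (KernelFork.ofι (k ≫ biprod.snd) hk') WalkingParallelPair.zero
  · exact (inferInstance : Mono (biprod.map (𝟙 D) f))

/-- Adding an identity to the two right-hand terms. -/
lemma SES.biprod_right {X Y Z : C} (h : SES X Y Z) (D : C) : SES X (Y ⊞ D) (Z ⊞ D) := by
  obtain ⟨f, g, w, hS⟩ := h
  have : Mono f := hS.mono_f
  have : Epi g := hS.epi_g
  have hw : (f ≫ biprod.inl) ≫ biprod.map g (𝟙 D) = 0 := by simp [reassoc_of% w]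
  refine ⟨_, _, hw, .mk' (ShortComplex.exact_of_f_is_kernel _ ?_) (mono_comp _ _) ?_⟩
  · refine KernelFork.IsLimit.ofι' _ _ fun {W} k hk => ?_
    have hk' : (k ≫ biprod.fst) ≫ g = 0 := by simpa using hk =≫ biprod.fst
    refine ⟨hS.fIsKernel.lift (KernelFork.ofι (k ≫ biprod.fst) hk'), ?_⟩
    have := hS.fIsKernel.fac (KernelFork.ofι (k ≫ biprod.fst) hk') WalkingParallelPair.zero
    apply biprod.hom_ext
    · simpa using this
    · simpa using (hk =≫ biprod.snd).symm
  · exact (inferInstance : Epi (biprod.map g (𝟙 D)))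

section Ext

variable [EnoughProjectives C]

/-- The derived-functor `Ext` and the derived-category `Ext` vanish simultaneously. -/
lemma extZero_succ_iff [HasExt.{w} C] (i : ℕ) (X Y : C) :
    extZero C (i + 1) X Y ↔ Subsingleton (Abelian.Ext.{w} X Y (i + 1)) := by
  let P := projectiveResolution X
  have h₁ : extZero C (i + 1) X Y ↔ ∀ f : P.complex.X (i + 1) ⟶ Y,
      P.complex.d (i + 2) (i + 1) ≫ f = 0 →
        ∃ g : P.complex.X i ⟶ Y, P.complex.d (i + 1) i ≫ g = f := by
    rw [extZero, (P.isoExt (R := ℤ) (i + 1) Y).isZero_iff,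
      ← HomologicalComplex.exactAt_iff_isZero_homology,
      HomologicalComplex.exactAt_iff' _ i (i + 1) (i + 2) (by simp) (by simp),
      ShortComplex.moduleCat_exact_iff]
    rfl
  rw [h₁]
  constructor
  · intro h
    refine ⟨fun a b => ?_⟩
    have key (a : Abelian.Ext.{w} X Y (i + 1)) : a = 0 := by
      obtain ⟨f, hf, rfl⟩ := P.extMk_surjective a (i + 2) rfl
      exact (P.extMk_eq_zero_iff f (i + 2) rfl hf i rfl).2 (h f hf)
    rw [key a, key b]
  · intro h f hf
    exact (P.extMk_eq_zero_iff f (i + 2) rfl hf i rfl).1 (Subsingleton.elim _ _)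

lemma extZero_iff [HasExt.{w} C] {i : ℕ} (hi : 1 ≤ i) (X Y : C) :
    extZero C i X Y ↔ Subsingleton (Abelian.Ext.{w} X Y i) := by
  obtain ⟨i, rfl⟩ := Nat.exists_eq_add_of_le' hi
  exact extZero_succ_iff i X Y

lemma extZero_of_retract_right {i : ℕ} {X Y Y' : C} (r : Retract Y Y') (h : extZero C i X Y') :
    extZero C i X Y :=
  IsZero.of_mono (r.map ((Ext ℤ C i).obj (op X))).i h

lemma extZero_of_retract_left {i : ℕ} {X X' Y : C} (r : Retract X X') (h : extZero C i X' Y) :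
    extZero C i X Y :=
  IsZero.of_mono (r.op.map ((Ext ℤ C i).flip.obj Y)).i h

section LongExactSequence

variable {X Y Z W : C} {i : ℕ}

lemma SES.extZero_right₂ (h : SES X Y Z) (hi : 1 ≤ i) (hX : extZero C i W X)
    (hZ : extZero C i W Z) : extZero C i W Y := by
  obtain ⟨f, g, w, hS⟩ := h
  have := HasExt.standard C
  rw [extZero_iff hi] at hX hZ ⊢
  refine subsingleton_of_forall_eq 0 fun a => ?_
  obtain ⟨b, rfl⟩ := Abelian.Ext.covariant_sequence_exact₂ _ hS a (Subsingleton.elim _ _)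
  rw [Subsingleton.elim b 0, Abelian.Ext.zero_comp]

lemma SES.extZero_right₁ (h : SES X Y Z) (hi : 1 ≤ i) (hZ : extZero C i W Z)
    (hY : extZero C (i + 1) W Y) : extZero C (i + 1) W X := by
  obtain ⟨f, g, w, hS⟩ := h
  have := HasExt.standard C
  rw [extZero_iff (by lia)] at hZ hY ⊢
  refine subsingleton_of_forall_eq 0 fun a => ?_
  obtain ⟨b, rfl⟩ := Abelian.Ext.covariant_sequence_exact₁ _ hS a (Subsingleton.elim _ _) rfl
  rw [Subsingleton.elim b 0, Abelian.Ext.zero_comp]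

lemma SES.extZero_right₃ (h : SES X Y Z) (hi : 1 ≤ i) (hY : extZero C i W Y)
    (hX : extZero C (i + 1) W X) : extZero C i W Z := by
  obtain ⟨f, g, w, hS⟩ := h
  have := HasExt.standard C
  rw [extZero_iff (by lia)] at hX hY ⊢
  refine subsingleton_of_forall_eq 0 fun a => ?_
  obtain ⟨b, rfl⟩ := Abelian.Ext.covariant_sequence_exact₃ _ hS a rfl (Subsingleton.elim _ _)
  rw [Subsingleton.elim b 0, Abelian.Ext.zero_comp]

lemma SES.extZero_left₂ (h : SES X Y Z) (hi : 1 ≤ i) (hX : extZero C i X W)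
    (hZ : extZero C i Z W) : extZero C i Y W := by
  obtain ⟨f, g, w, hS⟩ := h
  have := HasExt.standard C
  rw [extZero_iff hi] at hX hZ ⊢
  refine subsingleton_of_forall_eq 0 fun a => ?_
  obtain ⟨b, rfl⟩ := Abelian.Ext.contravariant_sequence_exact₂ hS _ a (Subsingleton.elim _ _)
  rw [Subsingleton.elim b 0, Abelian.Ext.comp_zero]

lemma SES.extZero_left₁ (h : SES X Y Z) (hi : 1 ≤ i) (hY : extZero C i Y W)
    (hZ : extZero C (i + 1) Z W) : extZero C i X W := by
  obtain ⟨f, g, w, hS⟩ := h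
  have := HasExt.standard C
  rw [extZero_iff (by lia)] at hZ hY ⊢
  refine subsingleton_of_forall_eq 0 fun a => ?_
  obtain ⟨b, rfl⟩ := Abelian.Ext.contravariant_sequence_exact₁ hS _ a (add_comm _ _)
    (Subsingleton.elim _ _)
  rw [Subsingleton.elim b 0, Abelian.Ext.comp_zero]

lemma SES.extZero_left₃ (h : SES X Y Z) (hi : 1 ≤ i) (hX : extZero C i X W)
    (hY : extZero C (i + 1) Y W) : extZero C (i + 1) Z W := by
  obtain ⟨f, g, w, hS⟩ := h
  have := HasExt.standard C
  rw [extZero_iff (by lia)] at hX hY ⊢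
  refine subsingleton_of_forall_eq 0 fun a => ?_
  obtain ⟨b, rfl⟩ := Abelian.Ext.contravariant_sequence_exact₃ hS _ a (Subsingleton.elim _ _)
    (add_comm _ _)
  rw [Subsingleton.elim b 0, Abelian.Ext.comp_zero]

/-- An extension by a vanishing `Ext¹` splits. -/
lemma SES.nonempty_iso_biprod (h : SES X Y Z) (hZ : extZero C 1 Z X) : Nonempty (Y ≅ X ⊞ Z) := by
  obtain ⟨f, g, w, hS⟩ := h
  have := HasExt.standard C
  rw [extZero_iff le_rfl] at hZ
  obtain ⟨b, hb⟩ := Abelian.Ext.contravariant_sequence_exact₁ hS X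
    (Abelian.Ext.mk₀ (𝟙 X)) (add_zero 1) (Subsingleton.elim _ _)
  obtain ⟨r, rfl⟩ := (Abelian.Ext.mk₀_bijective _ _).2 b
  rw [Abelian.Ext.mk₀_comp_mk₀] at hb
  exact ⟨(ShortComplex.Splitting.ofExactOfRetraction _ hS.exact r
    ((Abelian.Ext.mk₀_bijective _ _).1 hb) hS.epi_g).isoBinaryBiproduct⟩

end LongExactSequence

end Ext

section AddClosure

variable {T : C}

/-- The retract of a binary biproduct given by its first summand. -/
def retractBiprodFst (X Y : C) : Retract X (X ⊞ Y) where
  i := biprod.inl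
  r := biprod.fst

lemma nsum_mem_addOf (T : C) (n : ℕ) : nsum T n ∈ addOf T :=
  ⟨n, 0, ⟨(isoBiprodZero (isZero_zero C)).symm⟩⟩

lemma self_mem_addOf (T : C) : T ∈ addOf T := nsum_mem_addOf T 0

lemma mem_addOf_of_iso {X Y : C} (e : X ≅ Y) (h : Y ∈ addOf T) : X ∈ addOf T := by
  obtain ⟨n, Z, ⟨e'⟩⟩ := h
  exact ⟨n, Z, ⟨biprod.mapIso e (Iso.refl Z) ≪≫ e'⟩⟩

lemma mem_addOf_of_biprod_right {X Y : C} (h : (X ⊞ Y) ∈ addOf T) : Y ∈ addOf T := by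
  obtain ⟨n, Z, ⟨e⟩⟩ := h
  exact ⟨n, X ⊞ Z, ⟨(biprod.associator Y X Z).symm ≪≫
    biprod.mapIso (biprod.braiding Y X) (Iso.refl Z) ≪≫ e⟩⟩

lemma isZero_mem_addOf {Z : C} (hZ : IsZero Z) : Z ∈ addOf T :=
  ⟨0, T, ⟨(isoZeroBiprod hZ).symm⟩⟩

lemma nonempty_nsum_biprod_iso (T : C) (n m : ℕ) :
    Nonempty (nsum T n ⊞ nsum T m ≅ nsum T (n + m + 1)) := by
  induction n with
  | zero => exact ⟨by rw [zero_add]; exact Iso.refl _⟩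
  | succ n ih =>
    obtain ⟨e⟩ := ih
    rw [show n + 1 + m + 1 = (n + m + 1) + 1 by lia]
    exact ⟨biprod.associator T (nsum T n) (nsum T m) ≪≫ biprod.mapIso (Iso.refl T) e⟩

lemma biprod_mem_addOf {X Y : C} (hX : X ∈ addOf T) (hY : Y ∈ addOf T) : (X ⊞ Y) ∈ addOf T := by
  obtain ⟨n, X', ⟨e⟩⟩ := hX
  obtain ⟨m, Y', ⟨e'⟩⟩ := hY
  obtain ⟨e''⟩ := nonempty_nsum_biprod_iso T n m
  have h : (X ⊞ X') ⊞ (Y ⊞ Y') ≅ (X ⊞ Y) ⊞ (X' ⊞ Y') :=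
    biprod.associator _ _ _ ≪≫ biprod.mapIso (Iso.refl X)
      ((biprod.associator _ _ _).symm ≪≫ biprod.mapIso (biprod.braiding _ _) (Iso.refl _) ≪≫
        biprod.associator _ _ _) ≪≫ (biprod.associator _ _ _).symm
  exact ⟨n + m + 1, X' ⊞ Y', ⟨h.symm ≪≫ biprod.mapIso e e' ≪≫ e''⟩⟩

variable [EnoughProjectives C]

lemma extZero_of_mem_addOf_left {P Y : C} {i : ℕ} (hi : 1 ≤ i) (hP : P ∈ addOf T)
    (h : extZero C i T Y) : extZero C i P Y := by
  obtain ⟨n, P', ⟨e⟩⟩ := hP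
  refine extZero_of_retract_left ((retractBiprodFst P P').trans (.ofIso e)) ?_
  clear e
  induction n with
  | zero => exact h
  | succ n ih => exact (SES.biprod_inl_snd T (nsum T n)).extZero_left₂ hi h ih

lemma extZero_of_mem_addOf_right {X P : C} {i : ℕ} (hi : 1 ≤ i) (hP : P ∈ addOf T)
    (h : extZero C i X T) : extZero C i X P := by
  obtain ⟨n, P', ⟨e⟩⟩ := hP
  refine extZero_of_retract_right ((retractBiprodFst P P').trans (.ofIso e)) ?_
  clear e
  induction n with
  | zero => exact h
  | succ n ih => exact (SES.biprod_inl_snd T (nsum T n)).extZero_right₂ hi h ih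

lemma mem_rightPerp_addOf {Y : C} (h : ∀ i ≥ 1, extZero C i T Y) : Y ∈ rightPerp (addOf T) :=
  fun _ hP i hi => extZero_of_mem_addOf_left hi hP (h i hi)

/-- `T` has no self-extensions in positive degrees. -/
abbrev SelfOrthObj (T : C) : Prop := ∀ i ≥ 1, extZero C i T T

lemma SelfOrthObj.addOf_subset_rightPerp (hT : SelfOrthObj T) : addOf T ⊆ rightPerp (addOf T) :=
  fun _ hP => mem_rightPerp_addOf fun i hi => extZero_of_mem_addOf_right hi hP (hT i hi)

end AddClosure

section Perp

variable [EnoughProjectives C] {ω : Set C} {X Y Z : C}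

lemma SES.mem_rightPerp₂ (h : SES X Y Z) (hX : X ∈ rightPerp ω) (hZ : Z ∈ rightPerp ω) :
    Y ∈ rightPerp ω :=
  fun W hW i hi => h.extZero_right₂ hi (hX W hW i hi) (hZ W hW i hi)

lemma SES.mem_rightPerp₃ (h : SES X Y Z) (hX : X ∈ rightPerp ω) (hY : Y ∈ rightPerp ω) :
    Z ∈ rightPerp ω :=
  fun W hW i hi => h.extZero_right₃ hi (hY W hW i hi) (hX W hW (i + 1) (by lia))

end Perp

section FiniteResolutions

variable {ω : Set C}

lemma mem_coresol_zero {X : C} (h : X ∈ ω) : X ∈ coresol ω 0 := ⟨X, h, ⟨Iso.refl X⟩⟩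

lemma coresol_subset_coresol {ω' : Set C} (h : ω ⊆ ω') (n : ℕ) : coresol ω n ⊆ coresol ω' n := by
  induction n with
  | zero => exact fun X ⟨W, hW, e⟩ => ⟨W, h hW, e⟩
  | succ n ih => exact fun X ⟨W, hW, X', hS, hX'⟩ => ⟨W, h hW, X', hS, ih hX'⟩

lemma coresol_subset_succ (h0 : (0 : C) ∈ ω) (n : ℕ) : coresol ω n ⊆ coresol ω (n + 1) := by
  induction n with
  | zero =>
    rintro X ⟨W, hW, ⟨e⟩⟩
    exact ⟨W, hW, 0, (SES.of_isZero_right X (isZero_zero C)).of_iso (Iso.refl _) e (Iso.refl _),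
      mem_coresol_zero h0⟩
  | succ n ih => exact fun X ⟨W, hW, X', hS, hX'⟩ => ⟨W, hW, X', hS, ih hX'⟩

lemma coresol_mono (h0 : (0 : C) ∈ ω) : Monotone (coresol ω) :=
  monotone_nat_of_le_succ (coresol_subset_succ h0)

variable [EnoughProjectives C]

/-- Objects right orthogonal to `ω` are right orthogonal to objects with finite
`ω`-coresolutions. -/
lemma extZero_of_mem_coresol_left {Y : C} (hY : Y ∈ rightPerp ω) {n : ℕ} {N : C}
    (hN : N ∈ coresol ω n) {i : ℕ} (hi : 1 ≤ i) : extZero C i N Y := by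
  induction n generalizing N i with
  | zero =>
    obtain ⟨W, hW, ⟨e⟩⟩ := hN
    exact extZero_of_retract_left (.ofIso e) (hY W hW i hi)
  | succ n ih =>
    obtain ⟨W, hW, N', hS, hN'⟩ := hN
    exact hS.extZero_left₁ hi (hY W hW i hi) (ih hN' (by lia))

lemma extZero_of_mem_coresol_right {P : C} (hP : ∀ W ∈ ω, ∀ i ≥ 1, extZero C i P W) {n : ℕ}
    {N : C} (hN : N ∈ coresol ω n) {i : ℕ} (hi : n < i) : extZero C i P N := by
  induction n generalizing N i with
  | zero =>
    obtain ⟨W, hW, ⟨e⟩⟩ := hN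
    exact extZero_of_retract_right (.ofIso e) (hP W hW i hi)
  | succ n ih =>
    obtain ⟨W, hW, N', hS, hN'⟩ := hN
    obtain ⟨j, rfl⟩ := Nat.exists_eq_add_of_le' (show 1 ≤ i by lia)
    exact hS.extZero_right₁ (by lia) (ih hN' (by lia)) (hP W hW _ hi.pos)

lemma extZero_of_mem_resol_left {Y : C} (hY : Y ∈ rightPerp ω) {n : ℕ} {N : C}
    (hN : N ∈ resol ω n) {i : ℕ} (hi : n < i) : extZero C i N Y := by
  induction n generalizing N i with
  | zero =>
    obtain ⟨W, hW, ⟨e⟩⟩ := hN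
    exact extZero_of_retract_left (.ofIso e) (hY W hW i hi)
  | succ n ih =>
    obtain ⟨W, hW, N', hS, hN'⟩ := hN
    obtain ⟨j, rfl⟩ := Nat.exists_eq_add_of_le' (show 1 ≤ i by lia)
    exact hS.extZero_left₃ (by lia) (ih hN' (by lia)) (hY W hW _ hi.pos)

/-- Objects with `add T`-coresolutions of length `n` are closed under extensions. -/
lemma SelfOrthObj.coresol_extension {T : C} (hT : SelfOrthObj T) {n : ℕ} {X Y Z : C}
    (h : SES X Y Z) (hX : X ∈ coresol (addOf T) n) (hZ : Z ∈ coresol (addOf T) n) :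
    Y ∈ coresol (addOf T) n := by
  induction n generalizing X Y Z with
  | zero =>
    obtain ⟨P, hP, ⟨e⟩⟩ := hX
    have hX := mem_addOf_of_iso e hP
    obtain ⟨Q, hQ, ⟨e'⟩⟩ := id hZ
    obtain ⟨e''⟩ := h.nonempty_iso_biprod
      (extZero_of_mem_coresol_left (hT.addOf_subset_rightPerp hX) hZ le_rfl)
    exact ⟨_, biprod_mem_addOf hX (mem_addOf_of_iso e' hQ), ⟨e''⟩⟩
  | succ n ih =>
    obtain ⟨P, hP, X', hSX, hX'⟩ := hX
    obtain ⟨Q, hQ, Z', hSZ, hZ'⟩ := id hZ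
    obtain ⟨F, hYF, hPF⟩ := h.pushout hSX
    obtain ⟨e⟩ := hPF.nonempty_iso_biprod
      (extZero_of_mem_coresol_left (hT.addOf_subset_rightPerp hP) hZ le_rfl)
    obtain ⟨G, hYG, hG⟩ := (hYF.of_iso (Iso.refl _) e (Iso.refl _)).comp_mono
      (hSZ.biprod_left P)
    exact ⟨_, biprod_mem_addOf hP hQ, G, hYG, ih hG hX' hZ'⟩

lemma SelfOrthObj.nsum_mem_coresol {T : C} (hT : SelfOrthObj T) {n : ℕ} {X : C}
    (hX : X ∈ coresol (addOf T) n) (m : ℕ) : nsum X m ∈ coresol (addOf T) n := by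
  induction m with
  | zero => exact hX
  | succ m ih => exact hT.coresol_extension (SES.biprod_inl_snd X (nsum X m)) hX ih

end FiniteResolutions

section InfiniteResolutions

variable {ω : Set C}

/-- Iterating a one-step resolution inside a class of objects. -/
lemma exists_resolution_of_forall_exists {V : Set C}
    (h : ∀ U ∈ V, ∃ W ∈ ω, ∃ U' ∈ V, SES U' W U) {M : C} (hM : M ∈ V) :
    ∃ K W : ℕ → C, K 0 = M ∧ (∀ i, W i ∈ ω) ∧ (∀ i, K i ∈ V) ∧
      ∀ i, SES (K (i + 1)) (W i) (K i) := by
  choose W hW U' hU' hS using h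
  let K : ℕ → V := fun n => Nat.rec ⟨M, hM⟩ (fun _ U => ⟨U' U.1 U.2, hU' U.1 U.2⟩) n
  exact ⟨fun n => (K n).1, fun n => W (K n).1 (K n).2, rfl, fun i => hW _ _,
    fun i => (K i).2, fun i => hS _ _⟩

variable [EnoughProjectives C]

lemma subset_omX {V : Set C} (hV : V ⊆ rightPerp ω)
    (h : ∀ U ∈ V, ∃ W ∈ ω, ∃ U' ∈ V, SES U' W U) : V ⊆ omX ω := by
  intro M hM
  obtain ⟨K, W, h0, hW, hK, hS⟩ := exists_resolution_of_forall_exists h hM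
  exact ⟨K, W, h0, hW, fun i => hV (hK _), hS⟩

lemma exists_of_mem_omX {M : C} (hM : M ∈ omX ω) :
    ∃ W ∈ ω, ∃ M' ∈ omX ω, M' ∈ rightPerp ω ∧ SES M' W M := by
  obtain ⟨K, W, rfl, hW, hK, hS⟩ := hM
  exact ⟨W 0, hW 0, K 1, ⟨fun i => K (i + 1), fun i => W (i + 1), rfl, fun i => hW _,
    fun i => hK _, fun i => hS _⟩, hK 0, hS 0⟩

lemma mem_omX_of_SES {M W M' : C} (hW : W ∈ ω) (hM' : M' ∈ omX ω) (hperp : M' ∈ rightPerp ω)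
    (hS : SES M' W M) : M ∈ omX ω := by
  obtain ⟨K, V, rfl, hV, hK, hS'⟩ := hM'
  refine ⟨fun i => i.casesOn M K, fun i => i.casesOn W V, rfl, ?_, ?_, ?_⟩
  · rintro (_ | i)
    exacts [hW, hV i]
  · rintro (_ | i)
    exacts [hperp, hK i]
  · rintro (_ | i)
    exacts [hS, hS' i]

variable {T : C}

lemma SelfOrthObj.omX_subset_rightPerp (hT : SelfOrthObj T) :
    omX (addOf T) ⊆ rightPerp (addOf T) := by
  intro M hM
  obtain ⟨W, hW, M', -, hperp, hS⟩ := exists_of_mem_omX hM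
  exact hS.mem_rightPerp₃ hperp (hT.addOf_subset_rightPerp hW)

lemma SelfOrthObj.addOf_subset_omX (hT : SelfOrthObj T) : addOf T ⊆ omX (addOf T) :=
  subset_omX hT.addOf_subset_rightPerp fun U hU =>
    ⟨U, hU, 0, isZero_mem_addOf (isZero_zero C), SES.of_isZero_left U (isZero_zero C)⟩

lemma SelfOrthObj.omX_extension (hT : SelfOrthObj T) {X Y Z : C} (h : SES X Y Z)
    (hX : X ∈ omX (addOf T)) (hZ : Z ∈ omX (addOf T)) : Y ∈ omX (addOf T) := by
  refine subset_omX (V := {Y | ∃ X ∈ omX (addOf T), ∃ Z ∈ omX (addOf T), SES X Y Z})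
    ?_ ?_ ⟨X, hX, Z, hZ, h⟩
  · rintro Y ⟨X, hX, Z, hZ, h⟩
    exact h.mem_rightPerp₂ (hT.omX_subset_rightPerp hX) (hT.omX_subset_rightPerp hZ)
  · rintro Y ⟨X, hX, Z, hZ, h⟩
    obtain ⟨P, hP, X', hX', -, hSX⟩ := exists_of_mem_omX hX
    obtain ⟨Q, hQ, Z', hZ', -, hSZ⟩ := exists_of_mem_omX hZ
    obtain ⟨V, hV, hVY⟩ := h.pullback hSZ
    obtain ⟨e⟩ := hV.nonempty_iso_biprod (hT.omX_subset_rightPerp hX Q hQ 1 le_rfl)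
    obtain ⟨L, hL, hL'⟩ := (hSX.biprod_right Q).comp_epi
      (hVY.of_iso (Iso.refl _) e (Iso.refl _))
    exact ⟨_, biprod_mem_addOf hP hQ, L, ⟨X', hX', Z', hZ', hL'⟩, hL⟩

/-- `_TX` is closed under kernels of epimorphisms that lie in `T^⊥`. -/
lemma SelfOrthObj.omX_of_SES_of_mem_rightPerp (hT : SelfOrthObj T) {M X Y : C} (h : SES M X Y)
    (hX : X ∈ omX (addOf T)) (hY : Y ∈ omX (addOf T)) (hM : M ∈ rightPerp (addOf T)) :
    M ∈ omX (addOf T) := by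
  obtain ⟨P, hP, Y', hY', -, hSY⟩ := exists_of_mem_omX hY
  obtain ⟨Z, hMZ, hZX⟩ := h.pullback hSY
  have hZ := hT.omX_extension hZX hY' hX
  obtain ⟨e⟩ := hMZ.nonempty_iso_biprod (hM P hP 1 le_rfl)
  obtain ⟨Q, hQ, G, hG, -, hSG⟩ := exists_of_mem_omX hZ
  obtain ⟨J, hJ, hGJ⟩ := hSG.comp_epi
    ((SES.biprod_inr_fst M P).of_iso (Iso.refl _) e.symm (Iso.refl _))
  have hJX := hT.omX_extension hGJ hG (hT.addOf_subset_omX hP)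
  exact mem_omX_of_SES hQ hJX (hT.omX_subset_rightPerp hJX) hJ

lemma SelfOrthObj.resol_subset_omX (hT : SelfOrthObj T) (n : ℕ) :
    resol (addOf T) n ⊆ omX (addOf T) := by
  induction n with
  | zero =>
    rintro X ⟨W, hW, ⟨e⟩⟩
    exact hT.addOf_subset_omX (mem_addOf_of_iso e hW)
  | succ n ih =>
    rintro X ⟨W, hW, X', hS, hX'⟩
    exact mem_omX_of_SES hW (ih hX') (hT.omX_subset_rightPerp (ih hX')) hS

/-- An infinite `add T`-resolution whose syzygies have uniformly bounded `Ext(T, -)` has all its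
syzygies in `T^⊥`. -/
lemma SelfOrthObj.mem_rightPerp_of_bounded (hT : SelfOrthObj T) {K W : ℕ → C}
    (hW : ∀ i, W i ∈ addOf T) (hS : ∀ i, SES (K (i + 1)) (W i) (K i)) (L : ℕ)
    (hL : ∀ i, ∀ P ∈ addOf T, ∀ j > L, extZero C j P (K i)) (i : ℕ) :
    K i ∈ rightPerp (addOf T) := by
  induction L with
  | zero => exact fun P hP j hj => hL i P hP j hj
  | succ L ih =>
    refine ih fun i P hP j hj => ?_
    exact (hS i).extZero_right₃ (by lia)
      (hT.addOf_subset_rightPerp (hW i) P hP j (by lia)) (hL (i + 1) P hP (j + 1) (by lia))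

/-- An object with an infinite resolution by objects of `add T`-codimension at most `k` embeds
into an object of `_TX` with cokernel of finite `add T`-codimension. -/
lemma SelfOrthObj.exists_SES_omX (hT : SelfOrthObj T) {k : ℕ} {K W : ℕ → C}
    (hW : ∀ i, W i ∈ coresol (addOf T) k) (hS : ∀ i, SES (K (i + 1)) (W i) (K i)) (L : ℕ)
    (hL : ∀ i, ∀ P ∈ addOf T, ∀ j > L, extZero C j P (K i)) :
    ∃ X ∈ omX (addOf T), ∃ N ∈ checkCat (addOf T), SES (K 0) X N := by
  have h0 : (0 : C) ∈ addOf T := isZero_mem_addOf (isZero_zero C)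
  induction k generalizing K W L with
  | zero =>
    have hW' (i) : W i ∈ addOf T := by
      obtain ⟨P, hP, ⟨e⟩⟩ := hW i
      exact mem_addOf_of_iso e hP
    have hK := hT.mem_rightPerp_of_bounded hW' hS L hL
    exact ⟨K 0, ⟨K, W, rfl, hW', fun i => hK _, hS⟩, 0,
      Set.mem_iUnion.2 ⟨0, mem_coresol_zero h0⟩, SES.of_isZero_right _ (isZero_zero C)⟩
  | succ k ih =>
    choose P hP W' hWP hW' using hW
    choose Q hPQ hKQ using fun i => (hS i).comp_mono (hWP i)
    choose E hQE hPE using fun i => (hKQ (i + 1)).pushout (hPQ i)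
    obtain ⟨X, hX, N, hN, hQX⟩ := ih (K := Q) (W := E)
      (fun i => hT.coresol_extension (hPE i)
        (coresol_mono h0 (Nat.zero_le k) (mem_coresol_zero (hP i))) (hW' (i + 1)))
      hQE (max k L) fun i R hR j hj => (hKQ i).extZero_right₂ (by lia)
        (hL i R hR j (by lia)) (extZero_of_mem_coresol_right
          (fun P hP => hT.addOf_subset_rightPerp hP R hR) (hW' i) (by lia))
    obtain ⟨m, hN⟩ := Set.mem_iUnion.1 hN
    obtain ⟨G, hKX, hG⟩ := (hKQ 0).comp_mono hQX
    exact ⟨X, hX, G, Set.mem_iUnion.2 ⟨max k m, hT.coresol_extension hG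
      (coresol_mono h0 (le_max_left _ _) (hW' 0)) (coresol_mono h0 (le_max_right _ _) hN)⟩, hKX⟩

end InfiniteResolutions

section TiltingPairs

variable [EnoughProjectives C] {S T : C}

/-- If every object of `add T` has a finite `add S`-resolution and `S` has a finite
`add T`-coresolution, then every object of `_SX` has a finite `_TX`-coresolution. -/
lemma omX_subset_checkCat_omX (hS : SelfOrthObj S) (hT : SelfOrthObj T) {n : ℕ}
    (hTS : addOf T ⊆ resol (addOf S) n) (hST : S ∈ checkCat (addOf T)) :
    omX (addOf S) ⊆ checkCat (omX (addOf T)) := by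
  intro M hM
  obtain ⟨k, hk⟩ := Set.mem_iUnion.1 hST
  obtain ⟨K, W, rfl, hW, hK, hSES⟩ := exists_resolution_of_forall_exists
    (V := omX (addOf S)) (ω := Set.range (nsum S)) (by
      intro U hU
      obtain ⟨W, hW, U', hU', -, h⟩ := exists_of_mem_omX hU
      obtain ⟨m, Y, ⟨e⟩⟩ := id hW
      have hY : Y ∈ addOf S :=
        mem_addOf_of_biprod_right (mem_addOf_of_iso e (nsum_mem_addOf S m))
      exact ⟨_, ⟨m, rfl⟩, _, hS.omX_extension (SES.biprod_inl_snd Y U')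
        (hS.addOf_subset_omX hY) hU', (h.biprod_left Y).of_iso (Iso.refl _)
          (biprod.braiding _ _ ≪≫ e) (Iso.refl _)⟩) hM
  obtain ⟨X, hX, N, hN, h⟩ := hT.exists_SES_omX (k := k) (K := K) (W := W)
    (fun i => by
      obtain ⟨m, hm⟩ := hW i
      exact hm ▸ hT.nsum_mem_coresol hk m) hSES n
    fun i P hP j hj => extZero_of_mem_resol_left (hS.omX_subset_rightPerp (hK i)) (hTS hP) hj
  obtain ⟨m, hN⟩ := Set.mem_iUnion.1 hN
  exact Set.mem_iUnion.2 ⟨m + 1, X, hX, N, h, coresol_subset_coresol hT.addOf_subset_omX m hN⟩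

lemma omX_subset_omX (hS : SelfOrthObj S) (hT : SelfOrthObj T) {n : ℕ}
    (hTS : addOf T ⊆ resol (addOf S) n) (hST : S ∈ checkCat (addOf T)) :
    omX (addOf T) ⊆ omX (addOf S) := by
  obtain ⟨k, hk⟩ := Set.mem_iUnion.1 hST
  have hperp : omX (addOf T) ⊆ rightPerp (addOf S) := fun M hM =>
    mem_rightPerp_addOf fun i hi =>
      extZero_of_mem_coresol_left (hT.omX_subset_rightPerp hM) hk hi
  have hz : (0 : C) ∈ omX (addOf S) := hS.addOf_subset_omX (isZero_mem_addOf (isZero_zero C))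
  intro M hM
  refine subset_omX (V := {Y | ∃ X ∈ omX (addOf S), ∃ Z ∈ omX (addOf T), SES X Y Z})
    ?_ ?_ ⟨0, hz, M, hM, SES.of_isZero_left M (isZero_zero C)⟩
  · rintro Y ⟨X, hX, Z, hZ, h⟩
    exact h.mem_rightPerp₂ (hS.omX_subset_rightPerp hX) (hperp hZ)
  · rintro Y ⟨X, hX, Z, hZ, h⟩
    obtain ⟨P, hP, Z', hZ', -, hSZ⟩ := exists_of_mem_omX hZ
    obtain ⟨V, hV, hVY⟩ := h.pullback hSZ
    have hVX := hS.omX_extension hV hX (hS.resol_subset_omX n (hTS hP))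
    obtain ⟨W, hW, G, hG, -, hSV⟩ := exists_of_mem_omX hVX
    obtain ⟨L, hL, hGL⟩ := hSV.comp_epi hVY
    exact ⟨W, hW, L, ⟨G, hG, Z', hZ', hGL⟩, hL⟩

lemma SelfOrthObj.mem_omX_of_mem_coresol (hS : SelfOrthObj S) {ω : Set C}
    (hω : ω ⊆ omX (addOf S)) {k : ℕ} {M : C} (hM : M ∈ coresol ω k)
    (hperp : M ∈ rightPerp (addOf S)) : M ∈ omX (addOf S) := by
  induction k generalizing M with
  | zero =>
    obtain ⟨X, hX, ⟨e⟩⟩ := hM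
    exact hS.omX_extension ((SES.of_isZero_right X (isZero_zero C)).of_iso (Iso.refl _) e.symm
      (Iso.refl _)) (hω hX) (hS.addOf_subset_omX (isZero_mem_addOf (isZero_zero C)))
  | succ k ih =>
    obtain ⟨X, hX, M', h, hM'⟩ := hM
    exact hS.omX_of_SES_of_mem_rightPerp h (hω hX)
      (ih hM' (h.mem_rightPerp₃ hperp (hS.omX_subset_rightPerp (hω hX)))) hperp

end TiltingPairs

end AbelianLemmas

section ArtinAlgebra

variable {R : Type} [CommRing R] [IsArtinianRing R]
variable {A : Type} [Ring A] [Algebra R A] [Module.Finite R A]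
variable [Abelian (FGModuleCat A)] [EnoughProjectives (FGModuleCat A)]
variable [EnoughInjectives (FGModuleCat A)]

theorem stmt14 (Cm Tm : FGModuleCat A) (n : ℕ)
    (htilt : nTiltingPair A Cm Tm n) :
    omX (addOf Cm) =
      checkCat (omX (addOf Tm)) ∩
        {M | ∀ i ≥ 1, extZero (FGModuleCat A) i Cm M} := by
  obtain ⟨⟨hC, hT, -, hCT⟩, hTC⟩ := htilt
  refine Set.Subset.antisymm (fun M hM => ⟨omX_subset_checkCat_omX hC hT hTC hCT hM,
    SelfOrthObj.omX_subset_rightPerp hC hM Cm (self_mem_addOf Cm)⟩) ?_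
  rintro M ⟨hM, hperp⟩
  obtain ⟨k, hM⟩ := Set.mem_iUnion.1 hM
  exact SelfOrthObj.mem_omX_of_mem_coresol hC (omX_subset_omX hC hT hTC hCT) hM
    (mem_rightPerp_addOf hperp)

end ArtinAlgebra
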